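/- Let M be an L-structure, A ⊆ M, and suppose M is strongly homogeneous over A. Let p, q, r be complete types over A such that p(M) and q(M), q(M) and r(M), and p(M) and r(M) are commensurable over A. Then m_p^q · m_q^r = m_p^r. -/

import Mathlib

open FirstOrder Set

namespace Unimod

universe u v w

variable (L : FirstOrder.Language.{u, v}) {M : Type w} [L.Structure M]

/-- Two tuples (indexed by `α`) satisfy the same `L`-formulas with parameters from `A`,
i.e. they have the same complete type over `A`. -/
def SameType (A : Set M) {α : Type*} (a b : α → M) : Prop :=
  ∀ φ : L.Formula (↥A ⊕ α),
    φ.Realize (Sum.elim (fun x => (x : M)) a) ↔ φ.Realize (Sum.elim (fun x => (x : M)) b)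

/-- The set of realizations of the complete type of the tuple `a` over `A`. -/
def typeSet (A : Set M) {α : Type*} (a : α → M) : Set (α → M) :=
  {b | SameType L A a b}

/-- A set is type-definable over `A` if it is an intersection of a family of `A`-definable
sets. -/
def TypeDefinable (A : Set M) {α : Type*} (s : Set (α → M)) : Prop :=
  ∃ S : Set (Set (α → M)), (∀ t ∈ S, A.Definable L t) ∧ s = ⋂₀ S

/-- View a set of pairs of tuples as a set of `Fin n ⊕ Fin m`-indexed tuples. -/
def pairSet {M : Type w} {n m : ℕ} (C : Set ((Fin n → M) × (Fin m → M))) :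
    Set ((Fin n ⊕ Fin m) → M) :=
  {v | (v ∘ Sum.inl, v ∘ Sum.inr) ∈ C}

/-- A correspondence over `A` between `X ⊆ M^n` and `Y ⊆ M^m`: a nonempty subset of `X × Y`,
type-definable over `A`, all of whose fibres and cofibres are finite. -/
structure IsCorrespondence (A : Set M) {n m : ℕ} (X : Set (Fin n → M)) (Y : Set (Fin m → M))
    (C : Set ((Fin n → M) × (Fin m → M))) : Prop where
  nonempty : C.Nonempty
  subset : C ⊆ X ×ˢ Y
  typeDefinable : TypeDefinable L A (pairSet C)
  finite_fibers : ∀ x ∈ X, {y | (x, y) ∈ C}.Finite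
  finite_cofibers : ∀ y ∈ Y, {x | (x, y) ∈ C}.Finite

/-- A uniform correspondence over `A` with constant fibre size `k` and cofibre size `ℓ`. -/
structure IsUniformCorrespondence (A : Set M) {n m : ℕ} (X : Set (Fin n → M))
    (Y : Set (Fin m → M)) (C : Set ((Fin n → M) × (Fin m → M))) (k ℓ : ℕ)
    extends IsCorrespondence L A X Y C : Prop where
  k_pos : 0 < k
  l_pos : 0 < ℓ
  fiber_card : ∀ x ∈ X, {y | (x, y) ∈ C}.ncard = k
  cofiber_card : ∀ y ∈ Y, {x | (x, y) ∈ C}.ncard = ℓ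

/-- A type-definable set `X` is measurable over `A` if every uniform correspondence over `A`
between `X` and itself is balanced. -/
def MeasurableOver (A : Set M) {n : ℕ} (X : Set (Fin n → M)) : Prop :=
  ∀ (C : Set ((Fin n → M) × (Fin n → M))) (k ℓ : ℕ),
    IsUniformCorrespondence L A X X C k ℓ → k = ℓ

/-- `X` and `Y` are commensurable over `A`, with common ratio `r`. -/
def CommensurableOverWithRatio (A : Set M) {n m : ℕ} (X : Set (Fin n → M))
    (Y : Set (Fin m → M)) (r : ℚ) : Prop :=
  (∃ C k ℓ, IsUniformCorrespondence L A X Y C k ℓ) ∧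
    ∀ C k ℓ, IsUniformCorrespondence L A X Y C k ℓ → (k : ℚ) / (ℓ : ℚ) = r

/-- `X` and `Y` are commensurable over `A`: there is a uniform correspondence over `A` between
them, and all such have the same ratio. -/
def CommensurableOver (A : Set M) {n m : ℕ} (X : Set (Fin n → M)) (Y : Set (Fin m → M)) : Prop :=
  ∃ r : ℚ, CommensurableOverWithRatio L A X Y r

/-- `M` is strongly homogeneous over `A`: any two tuples with the same type over `A` are
conjugate by an automorphism of `M` fixing `A` pointwise. -/
def StronglyHomogeneousOver (A : Set M) : Prop :=
  ∀ (n : ℕ) (a b : Fin n → M), SameType L A a b →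
    ∃ σ : M ≃[L] M, (∀ x ∈ A, σ x = x) ∧ ∀ i, σ (a i) = b i

/-- `M` is unimodular (with respect to the cardinal bound `κ` on parameter sets):
whenever `a ≡_A b` are interalgebraic over `A`, then `m(a/A ∪ b) = m(b/A ∪ a)`. -/
def Unimodular (κ : Cardinal.{w}) : Prop :=
  ∀ A : Set M, Cardinal.mk A < κ → ∀ (n : ℕ) (a b : Fin n → M),
    SameType L A a b →
    (typeSet L (A ∪ Set.range b) a).Finite →
    (typeSet L (A ∪ Set.range a) b).Finite →
    (typeSet L (A ∪ Set.range b) a).ncard = (typeSet L (A ∪ Set.range a) b).ncard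

/-- `M` is `κ`-saturated: every finitely satisfiable set of formulas in finitely many free
variables with parameters from a set of size `< κ` is realized in `M`. -/
def Saturated (κ : Cardinal.{w}) : Prop :=
  ∀ A : Set M, Cardinal.mk A < κ →
    ∀ (n : ℕ) (T : Set (L.Formula (↥A ⊕ Fin n))),
      (∀ T₀ : Finset (L.Formula (↥A ⊕ Fin n)), ↑T₀ ⊆ T →
        ∃ v : Fin n → M, ∀ φ ∈ T₀, φ.Realize (Sum.elim (fun x => (x : M)) v)) →
      ∃ v : Fin n → M, ∀ φ ∈ T, φ.Realize (Sum.elim (fun x => (x : M)) v)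

/-- A function `f : X → Y` is relatively definable over `A` if its graph is the intersection
of an `A`-definable set with `X × Y`. -/
def RelativelyDefinableFn (A : Set M) {n m : ℕ} (X : Set (Fin n → M)) (Y : Set (Fin m → M))
    (f : (Fin n → M) → (Fin m → M)) : Prop :=
  ∃ D : Set ((Fin n ⊕ Fin m) → M), A.Definable L D ∧
    ∀ x ∈ X, ∀ y ∈ Y, (Sum.elim x y ∈ D ↔ f x = y)

/-- The `≡_A`-class of the pair `c`. -/
def pairClass (A : Set M) {n m : ℕ} (c : (Fin n → M) × (Fin m → M)) :
    Set ((Fin n → M) × (Fin m → M)) :=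
  {p | SameType L A (Sum.elim c.1 c.2) (Sum.elim p.1 p.2)}

/-- A complete correspondence over `A`: a correspondence which is a single `≡_A`-class. -/
def IsCompleteCorrespondence (A : Set M) {n m : ℕ} (X : Set (Fin n → M)) (Y : Set (Fin m → M))
    (C : Set ((Fin n → M) × (Fin m → M))) : Prop :=
  IsCorrespondence L A X Y C ∧ ∃ c ∈ C, C = pairClass L A c


/-- The automorphisms of `M` fixing `A` pointwise, as a group of permutations of `M`. -/
def fixingAut (A : Set M) : Subgroup (Equiv.Perm M) where
  carrier := {σ | ∃ f : M ≃[L] M, f.toEquiv = σ ∧ ∀ x ∈ A, f x = x}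
  mul_mem' := by
    rintro _ _ ⟨f, rfl, hf⟩ ⟨g, rfl, hg⟩
    exact ⟨f.comp g, rfl, fun x hx => by simp [hg x hx, hf x hx]⟩
  one_mem' := ⟨Language.Equiv.refl L M, rfl, fun _ _ => rfl⟩
  inv_mem' := by
    rintro _ ⟨f, rfl, hf⟩
    refine ⟨f.symm, rfl, fun x hx => ?_⟩
    conv_lhs => rw [← hf x hx]
    exact f.symm_apply_apply x

variable {L}

theorem realize_smul_iff {A : Set M} {α : Type*} (g : fixingAut L A)
    (φ : L.Formula (A ⊕ α)) (v : α → M) :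
    φ.Realize (Sum.elim (fun x => (x : M)) (g • v)) ↔
      φ.Realize (Sum.elim (fun x => (x : M)) v) := by
  obtain ⟨f, hfg, hf⟩ := g.2
  have h : (Sum.elim (fun x : A => (x : M)) (g • v) : A ⊕ α → M) =
      f ∘ Sum.elim (fun x : A => (x : M)) v := by
    funext i
    rcases i with i | i
    · exact (hf i i.2).symm
    · exact (congrArg (fun σ : Equiv.Perm M => σ (v i)) hfg).symm
  rw [h, Language.StrongHomClass.realize_formula]

theorem sameType_smul {A : Set M} {α : Type*} (g : fixingAut L A) (v : α → M) :
    SameType L A v (g • v) := fun φ => (realize_smul_iff g φ v).symm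

theorem SameType.symm {A : Set M} {α : Type*} {v w : α → M} (h : SameType L A v w) :
    SameType L A w v := fun φ => (h φ).symm

theorem SameType.trans {A : Set M} {α : Type*} {u v w : α → M} (h : SameType L A u v)
    (h' : SameType L A v w) : SameType L A u w := fun φ => (h φ).trans (h' φ)

theorem SameType.comp {A : Set M} {α β : Type*} {v w : α → M} (h : SameType L A v w)
    (e : β → α) : SameType L A (v ∘ e) (w ∘ e) := by
  intro φ
  have key (u : α → M) : (φ.relabel (Sum.map id e)).Realize (Sum.elim (fun x : A => (x : M)) u) ↔
      φ.Realize (Sum.elim (fun x => (x : M)) (u ∘ e)) := by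
    rw [Language.Formula.realize_relabel, Sum.elim_comp_map]
    rfl
  rw [← key, ← key]
  exact h _

theorem typeSet_eq {A : Set M} {α : Type*} {v w : α → M} (h : SameType L A v w) :
    typeSet L A v = typeSet L A w :=
  Set.ext fun _ => ⟨h.symm.trans, h.trans⟩

theorem StronglyHomogeneousOver.exists_smul_eq {A : Set M} (hhom : StronglyHomogeneousOver L A)
    {α : Type*} [Finite α] {v w : α → M} (h : SameType L A v w) :
    ∃ g : fixingAut L A, g • v = w := by
  obtain ⟨n, ⟨e⟩⟩ := Finite.exists_equiv_fin α
  obtain ⟨f, hf, hv⟩ := hhom n _ _ (h.comp e.symm)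
  refine ⟨⟨f.toEquiv, f, rfl, hf⟩, funext fun i => ?_⟩
  have := hv (e i)
  simp only [Function.comp_apply, Equiv.symm_apply_apply] at this
  exact this

theorem StronglyHomogeneousOver.mem_pairClass {A : Set M} (hhom : StronglyHomogeneousOver L A)
    {n m : ℕ} {x x' : Fin n → M} {y y' : Fin m → M} :
    (x', y') ∈ pairClass L A (x, y) ↔ ∃ g : fixingAut L A, g • x = x' ∧ g • y = y' := by
  constructor
  · intro h
    obtain ⟨g, hg⟩ := hhom.exists_smul_eq h
    exact ⟨g, funext fun i => congrFun hg (Sum.inl i), funext fun i => congrFun hg (Sum.inr i)⟩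
  · rintro ⟨g, rfl, rfl⟩
    have h : Sum.elim (g • x) (g • y) = g • Sum.elim x y := by
      funext i
      rcases i with i | i <;> rfl
    change SameType L A (Sum.elim x y) (Sum.elim (g • x) (g • y))
    rw [h]
    exact sameType_smul g _

theorem typeDefinable_pairClass (A : Set M) {n m : ℕ} (x : Fin n → M) (y : Fin m → M) :
    TypeDefinable L A (pairSet (pairClass L A (x, y))) := by
  refine ⟨{t | A.Definable L t ∧ Sum.elim x y ∈ t}, fun t ht => ht.1, ?_⟩
  ext v
  have hv : v ∈ pairSet (pairClass L A (x, y)) ↔ SameType L A (Sum.elim x y) v := by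
    change SameType L A (Sum.elim x y) (Sum.elim (v ∘ Sum.inl) (v ∘ Sum.inr)) ↔ _
    rw [Sum.elim_comp_inl_inr]
  rw [hv]
  constructor
  · rintro h t ⟨ht, hxy⟩
    obtain ⟨φ, rfl⟩ := definable_iff_exists_formula_sum.1 ht
    exact (h φ).1 hxy
  · intro h φ
    constructor
    · intro hφ
      exact h {v | φ.Realize (Sum.elim (fun x => (x : M)) v)}
        ⟨definable_iff_exists_formula_sum.2 ⟨φ, rfl⟩, hφ⟩
    · intro hφ
      by_contra hn
      exact h {v | φ.Realize (Sum.elim (fun x => (x : M)) v)}ᶜ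
        ⟨(definable_iff_exists_formula_sum.2 ⟨φ, rfl⟩).compl, hn⟩ hφ

theorem TypeDefinable.smul_mem {A : Set M} {α : Type*} {s : Set (α → M)}
    (hs : TypeDefinable L A s) (g : fixingAut L A) {v : α → M} (hv : v ∈ s) : g • v ∈ s := by
  obtain ⟨S, hS, rfl⟩ := hs
  intro t ht
  obtain ⟨φ, rfl⟩ := definable_iff_exists_formula_sum.1 (hS t ht)
  exact (realize_smul_iff g φ v).2 (hv _ ht)

theorem smul_mem_of_typeDefinable_pairSet {A : Set M} {n m : ℕ}
    {C : Set ((Fin n → M) × (Fin m → M))} (hC : TypeDefinable L A (pairSet C))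
    (g : fixingAut L A) {x : Fin n → M} {y : Fin m → M} (h : (x, y) ∈ C) :
    (g • x, g • y) ∈ C :=
  hC.smul_mem g (v := Sum.elim x y) h

open MulAction in
theorem ncard_setOf_smul_eq {G X Y : Type*} [Group G] [MulAction G X] [MulAction G Y]
    (x x' : X) (y : Y) (h : ∃ g : G, g • x = x') :
    {y' | ∃ g : G, g • x = x' ∧ g • y = y'}.ncard =
      (stabilizer G y).relIndex (stabilizer G x) := by
  obtain ⟨k, rfl⟩ := h
  have himage : {y' | ∃ g : G, g • x = k • x ∧ g • y = y'} =
      (k • ·) '' orbit (stabilizer G x) y := by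
    ext y'
    constructor
    · rintro ⟨g, hg, rfl⟩
      refine ⟨(k⁻¹ * g) • y, ⟨⟨k⁻¹ * g, ?_⟩, rfl⟩, ?_⟩
      · rw [mem_stabilizer_iff, mul_smul, hg, inv_smul_smul]
      · simp [mul_smul]
    · rintro ⟨_, ⟨⟨g, hg⟩, rfl⟩, rfl⟩
      rw [mem_stabilizer_iff] at hg
      exact ⟨k * g, by rw [mul_smul, hg], mul_smul k g y⟩
  rw [himage, Set.ncard_image_of_injective _ (MulAction.injective k), ← index_stabilizer]
  rfl

open MulAction in
theorem relIndex_stabilizer_ne_zero {G X Y : Type*} [Group G] [MulAction G X] [MulAction G Y]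
    (x : X) (y : Y) {s : Set Y} (hs : s.Finite) (h : ∀ g : G, g • x = x → g • y ∈ s) :
    (stabilizer G y).relIndex (stabilizer G x) ≠ 0 := by
  rw [← ncard_setOf_smul_eq x x y ⟨1, one_smul _ _⟩]
  have hsub : {y' | ∃ g : G, g • x = x ∧ g • y = y'} ⊆ s := by
    rintro _ ⟨g, hg, rfl⟩
    exact h g hg
  exact Set.ncard_ne_zero_of_mem (a := y) ⟨1, one_smul _ _, one_smul _ _⟩ (hs.subset hsub)

theorem relIndex_mul_relIndex_mul_relIndex {G : Type*} [Group G] (H K N : Subgroup G)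
    (h : N.relIndex (H ⊓ K) ≠ 0) (hK : K.relIndex H ≠ 0) :
    K.relIndex H * N.relIndex K * H.relIndex N = H.relIndex K * K.relIndex N * N.relIndex H := by
  have e₁ : N.relIndex (H ⊓ K) * K.relIndex H = K.relIndex (H ⊓ N) * N.relIndex H := by
    rw [inf_comm H K, inf_comm H N, Subgroup.relIndex_inf_mul_relIndex,
      Subgroup.relIndex_inf_mul_relIndex, inf_comm]
  have e₂ : N.relIndex (H ⊓ K) * H.relIndex K = H.relIndex (N ⊓ K) * N.relIndex K := by
    rw [Subgroup.relIndex_inf_mul_relIndex, Subgroup.relIndex_inf_mul_relIndex, inf_comm]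
  have e₃ : K.relIndex (H ⊓ N) * H.relIndex N = H.relIndex (N ⊓ K) * K.relIndex N := by
    rw [inf_comm N K, Subgroup.relIndex_inf_mul_relIndex, Subgroup.relIndex_inf_mul_relIndex,
      inf_comm]
  have hpos : K.relIndex (H ⊓ N) ≠ 0 := by
    intro hz
    rw [hz, zero_mul] at e₁
    exact mul_ne_zero h hK e₁
  apply mul_left_cancel₀ (mul_ne_zero h hpos)
  calc N.relIndex (H ⊓ K) * K.relIndex (H ⊓ N) *
        (K.relIndex H * N.relIndex K * H.relIndex N)
      = (N.relIndex (H ⊓ K) * K.relIndex H) * (K.relIndex (H ⊓ N) * H.relIndex N) *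
          N.relIndex K := by ring
    _ = (K.relIndex (H ⊓ N) * N.relIndex H) * (H.relIndex (N ⊓ K) * K.relIndex N) *
          N.relIndex K := by rw [e₁, e₃]
    _ = K.relIndex (H ⊓ N) * N.relIndex H * K.relIndex N *
          (H.relIndex (N ⊓ K) * N.relIndex K) := by ring
    _ = K.relIndex (H ⊓ N) * N.relIndex H * K.relIndex N *
          (N.relIndex (H ⊓ K) * H.relIndex K) := by rw [e₂]
    _ = _ := by ring

open MulAction in
theorem StronglyHomogeneousOver.isUniformCorrespondence_pairClass {A : Set M}
    (hhom : StronglyHomogeneousOver L A) {n m : ℕ} (x : Fin n → M) (y : Fin m → M)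
    (hxy : (stabilizer (fixingAut L A) y).relIndex (stabilizer (fixingAut L A) x) ≠ 0)
    (hyx : (stabilizer (fixingAut L A) x).relIndex (stabilizer (fixingAut L A) y) ≠ 0) :
    IsUniformCorrespondence L A (typeSet L A x) (typeSet L A y) (pairClass L A (x, y))
      ((stabilizer (fixingAut L A) y).relIndex (stabilizer (fixingAut L A) x))
      ((stabilizer (fixingAut L A) x).relIndex (stabilizer (fixingAut L A) y)) := by
  have fiber : ∀ x' ∈ typeSet L A x, {y' | (x', y') ∈ pairClass L A (x, y)}.ncard =
      (stabilizer (fixingAut L A) y).relIndex (stabilizer (fixingAut L A) x) := by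
    intro x' hx'
    rw [← ncard_setOf_smul_eq x x' y (hhom.exists_smul_eq hx')]
    simp only [hhom.mem_pairClass]
  have cofiber : ∀ y' ∈ typeSet L A y, {x' | (x', y') ∈ pairClass L A (x, y)}.ncard =
      (stabilizer (fixingAut L A) x).relIndex (stabilizer (fixingAut L A) y) := by
    intro y' hy'
    rw [← ncard_setOf_smul_eq y y' x (hhom.exists_smul_eq hy')]
    simp only [hhom.mem_pairClass, and_comm]
  refine ⟨⟨⟨(x, y), fun φ => Iff.rfl⟩, ?_, typeDefinable_pairClass A x y, ?_, ?_⟩,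
    Nat.pos_of_ne_zero hxy, Nat.pos_of_ne_zero hyx, fiber, cofiber⟩
  · rintro ⟨x', y'⟩ h
    obtain ⟨g, rfl, rfl⟩ := hhom.mem_pairClass.1 h
    exact ⟨sameType_smul g x, sameType_smul g y⟩
  · exact fun x' hx' => Set.finite_of_ncard_ne_zero (by rwa [fiber x' hx'])
  · exact fun y' hy' => Set.finite_of_ncard_ne_zero (by rwa [cofiber y' hy'])

open MulAction in
theorem IsCorrespondence.relIndex_ne_zero {A : Set M} {n m : ℕ} {X : Set (Fin n → M)}
    {Y : Set (Fin m → M)} {C : Set ((Fin n → M) × (Fin m → M))} (hC : IsCorrespondence L A X Y C)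
    {x : Fin n → M} {y : Fin m → M} (h : (x, y) ∈ C) :
    (stabilizer (fixingAut L A) y).relIndex (stabilizer (fixingAut L A) x) ≠ 0 ∧
      (stabilizer (fixingAut L A) x).relIndex (stabilizer (fixingAut L A) y) ≠ 0 := by
  constructor
  · refine relIndex_stabilizer_ne_zero x y (hC.finite_fibers x (hC.subset h).1) fun g hg => ?_
    have := smul_mem_of_typeDefinable_pairSet hC.typeDefinable g h
    rwa [hg] at this
  · refine relIndex_stabilizer_ne_zero y x (hC.finite_cofibers y (hC.subset h).2) fun g hg => ?_
    have := smul_mem_of_typeDefinable_pairSet hC.typeDefinable g h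
    rwa [hg] at this

theorem IsUniformCorrespondence.exists_mem {A : Set M} {n m : ℕ} {X : Set (Fin n → M)}
    {Y : Set (Fin m → M)} {C : Set ((Fin n → M) × (Fin m → M))} {k l : ℕ}
    (hC : IsUniformCorrespondence L A X Y C k l) {x : Fin n → M} (hx : x ∈ X) :
    ∃ y, (x, y) ∈ C :=
  Set.nonempty_of_ncard_ne_zero (s := {y | (x, y) ∈ C}) <| by
    rw [hC.fiber_card x hx]
    exact hC.k_pos.ne'

/-- For pairwise commensurable complete types `p`, `q`, `r` over `A`, the ratios
multiply: `m_p^q · m_q^r = m_p^r`. -/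
theorem statement12 (L : FirstOrder.Language.{u, v}) (M : Type w) [L.Structure M]
    (A : Set M) (hhom : StronglyHomogeneousOver L A) (n₁ n₂ n₃ : ℕ)
    (a : Fin n₁ → M) (b : Fin n₂ → M) (c : Fin n₃ → M)
    (mpq mqr mpr : ℚ)
    (hpq : CommensurableOverWithRatio L A (typeSet L A a) (typeSet L A b) mpq)
    (hqr : CommensurableOverWithRatio L A (typeSet L A b) (typeSet L A c) mqr)
    (hpr : CommensurableOverWithRatio L A (typeSet L A a) (typeSet L A c) mpr) :
    mpq * mqr = mpr := by
  obtain ⟨⟨C, k, l, hC⟩, hpq⟩ := hpq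
  obtain ⟨⟨D, k', l', hD⟩, hqr⟩ := hqr
  obtain ⟨y, hy⟩ := hC.exists_mem (x := a) fun _ => Iff.rfl
  have hby : y ∈ typeSet L A b := (hC.subset hy).2
  obtain ⟨z, hz⟩ := hD.exists_mem hby
  have hcz : z ∈ typeSet L A c := (hD.subset hz).2
  obtain ⟨hya, hay⟩ := hC.relIndex_ne_zero hy
  obtain ⟨hzy, hyz⟩ := hD.relIndex_ne_zero hz
  have hza := Subgroup.relIndex_ne_zero_trans hzy hya
  have haz := Subgroup.relIndex_ne_zero_trans hay hyz
  rw [typeSet_eq hby] at hpq hqr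
  rw [typeSet_eq hcz] at hqr
  have hpr := hpr.2
  rw [typeSet_eq hcz] at hpr
  rw [← hpq _ _ _ (hhom.isUniformCorrespondence_pairClass a y hya hay),
    ← hqr _ _ _ (hhom.isUniformCorrespondence_pairClass y z hzy hyz),
    ← hpr _ _ _ (hhom.isUniformCorrespondence_pairClass a z hza haz),
    div_mul_div_comm, div_eq_div_iff (by positivity) (by positivity)]
  have key := relIndex_mul_relIndex_mul_relIndex (MulAction.stabilizer (fixingAut L A) a)
    (MulAction.stabilizer (fixingAut L A) y) (MulAction.stabilizer (fixingAut L A) z)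
    (mt (Subgroup.relIndex_eq_zero_of_le_right inf_le_right) hzy) hya
  rw [mul_comm (Nat.cast (Subgroup.relIndex _ _) : ℚ) (_ * _)]
  exact_mod_cast key

end Unimod
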